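/- arXiv:1509.02023 — 2 statements merged into one kernel-verified Lean document; each statement's English description precedes it below -/
import Mathlib

section
/- Let x* ∈ Δⁿ be a probability vector, let 2 ≤ p < ∞, let λ > 0, let ε > 0, and let k be a positive integer. Let I_1, …, I_k be independent random indices in {1,…,n}, each distributed according to x* (P(I_t = i) = x*_i), and let x' = (1/k)·Σ_{t=1}^k e_{I_t}, where e_i is the i-th standard basis vector of ℝⁿ. Then P( ‖x' − x*‖_p ≥ ε/(4λ) ) ≤ 8λ√p/(ε√k). -/
open Finset
open scoped Classical

/-- The `L_p` norm of a vector in `ℝ^n` (for a real exponent `p`). -/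
noncomputable def lpNorm {n : ℕ} (p : ℝ) (x : Fin n → ℝ) : ℝ :=
  (∑ i, |x i| ^ p) ^ (1 / p)

theorem lpNorm_le_sqrt_sum_sq {n : ℕ} {p : ℝ} (hp : 2 ≤ p) (v : Fin n → ℝ) :
    lpNorm p v ≤ Real.sqrt (∑ i, v i ^ 2) := by
  set r := Real.sqrt (∑ i, v i ^ 2) with hr
  have hr0 : 0 ≤ r := Real.sqrt_nonneg _
  have hsq : r ^ 2 = ∑ i, v i ^ 2 := Real.sq_sqrt (Finset.sum_nonneg fun i _ => sq_nonneg _)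
  have split (a : ℝ) (ha : 0 ≤ a) : a ^ p = a ^ 2 * a ^ (p - 2) := by
    rw [← Real.rpow_natCast a 2, ← Real.rpow_add_of_nonneg ha (by norm_num) (by linarith)]
    congr 1
    push_cast
    ring
  have hle (i : Fin n) : |v i| ≤ r :=
    Real.abs_le_sqrt (Finset.single_le_sum (f := fun i => v i ^ 2)
      (fun i _ => sq_nonneg _) (Finset.mem_univ i))
  have key : ∑ i, |v i| ^ p ≤ r ^ p := by
    rw [split r hr0, hsq, Finset.sum_mul]
    refine Finset.sum_le_sum fun i _ => ?_
    rw [split _ (abs_nonneg _), sq_abs]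
    exact mul_le_mul_of_nonneg_left
      (Real.rpow_le_rpow (abs_nonneg _) (hle i) (by linarith)) (sq_nonneg _)
  calc lpNorm p v ≤ (r ^ p) ^ (1 / p) :=
        Real.rpow_le_rpow (Finset.sum_nonneg fun i _ => by positivity) key (by positivity)
    _ = r := by
        rw [one_div, Real.rpow_rpow_inv hr0 (by linarith)]

theorem sum_fin_succ_pi {α : Type*} [Fintype α] {k : ℕ} (F : (Fin (k + 1) → α) → ℝ) :
    ∑ I, F I = ∑ a, ∑ I : Fin k → α, F (Fin.cons a I) := by
  rw [← (Fin.consEquiv fun _ => α).sum_comp, Fintype.sum_prod_type]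
  rfl

theorem sum_prod_weights {α : Type*} [Fintype α] {x : α → ℝ} (hx : ∑ a, x a = 1) (k : ℕ) :
    ∑ I : Fin k → α, ∏ t, x (I t) = 1 := by
  induction k with
  | zero => simp
  | succ k ih => simp [sum_fin_succ_pi, Fin.prod_univ_succ, ← Finset.mul_sum, ih, hx]

/-- The mean of a sum of i.i.d. centered variables vanishes. -/
theorem sum_prod_weights_mul_sum {α : Type*} [Fintype α] {x : α → ℝ} (hx : ∑ a, x a = 1)
    {f : α → ℝ} (hf : ∑ a, x a * f a = 0) (k : ℕ) :
    ∑ I : Fin k → α, (∏ t, x (I t)) * ∑ t, f (I t) = 0 := by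
  induction k with
  | zero => simp
  | succ k ih =>
    have step (a : α) : ∑ I : Fin k → α, x a * (∏ t, x (I t)) * (f a + ∑ t, f (I t))
        = x a * f a := by
      have h (I : Fin k → α) : x a * (∏ t, x (I t)) * (f a + ∑ t, f (I t))
          = x a * f a * (∏ t, x (I t)) + x a * ((∏ t, x (I t)) * ∑ t, f (I t)) := by ring
      simp only [h, Finset.sum_add_distrib, ← Finset.mul_sum, ih, sum_prod_weights hx]
      ring
    simp [sum_fin_succ_pi, Fin.prod_univ_succ, Fin.sum_univ_succ, step, hf]

/-- The variance of a sum of `k` i.i.d. centered variables is `k` times their variance. -/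
theorem sum_prod_weights_mul_sum_sq {α : Type*} [Fintype α] {x : α → ℝ} (hx : ∑ a, x a = 1)
    {f : α → ℝ} (hf : ∑ a, x a * f a = 0) (k : ℕ) :
    ∑ I : Fin k → α, (∏ t, x (I t)) * (∑ t, f (I t)) ^ 2 = k * ∑ a, x a * f a ^ 2 := by
  induction k with
  | zero => simp
  | succ k ih =>
    have step (a : α) : ∑ I : Fin k → α, x a * (∏ t, x (I t)) * (f a + ∑ t, f (I t)) ^ 2
        = x a * f a ^ 2 + x a * (k * ∑ a, x a * f a ^ 2) := by
      have h (I : Fin k → α) : x a * (∏ t, x (I t)) * (f a + ∑ t, f (I t)) ^ 2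
          = x a * f a ^ 2 * (∏ t, x (I t))
            + 2 * x a * f a * ((∏ t, x (I t)) * ∑ t, f (I t))
            + x a * ((∏ t, x (I t)) * (∑ t, f (I t)) ^ 2) := by ring
      simp only [h, Finset.sum_add_distrib, ← Finset.mul_sum, ih, sum_prod_weights hx,
        sum_prod_weights_mul_sum hx hf]
      ring
    simp only [sum_fin_succ_pi, Fin.prod_univ_succ, Fin.sum_univ_succ, Fin.cons_zero,
      Fin.cons_succ, step, Finset.sum_add_distrib, ← Finset.sum_mul, hx]
    push_cast
    ring

/-- The expected squared Euclidean distance between a distribution and the empirical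
distribution of `k` samples is at most `1 / k`. -/
theorem sum_prod_weights_mul_sq_dist_le {n : ℕ} {x : Fin n → ℝ}
    (hx : x ∈ stdSimplex ℝ (Fin n)) {k : ℕ} (hk : 0 < k) :
    ∑ I : Fin k → Fin n, (∏ t, x (I t)) *
      ∑ i, ((k : ℝ)⁻¹ • ((∑ t, Pi.single (I t) 1 : Fin n → ℝ)) - x) i ^ 2 ≤ (k : ℝ)⁻¹ := by
  obtain ⟨hx0, hx1⟩ := hx
  have hk' : (k : ℝ) ≠ 0 := by positivity
  let f (i a : Fin n) : ℝ := Pi.single (M := fun _ => ℝ) a 1 i - x i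
  have mean (i : Fin n) : ∑ a, x a * f i a = 0 := by
    simp [f, mul_sub, Finset.sum_sub_distrib, ← Finset.sum_mul, hx1, Pi.single_apply]
  have var (i : Fin n) : ∑ a, x a * f i a ^ 2 ≤ x i := by
    have h (a : Fin n) : x a * f i a ^ 2
        = (if i = a then x a * (1 - 2 * x i) else 0) + x a * x i ^ 2 := by
      by_cases hia : i = a
      · simp [f, hia]; ring
      · simp [f, hia]
    simp only [h, Finset.sum_add_distrib, ← Finset.sum_mul, hx1, Finset.sum_ite_eq,
      Finset.mem_univ, if_true]
    nlinarith [sq_nonneg (x i)]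
  have coord (I : Fin k → Fin n) (i : Fin n) :
      ((k : ℝ)⁻¹ • ((∑ t, Pi.single (I t) 1 : Fin n → ℝ)) - x) i
        = (k : ℝ)⁻¹ * ∑ t, f i (I t) := by
    simp only [f, Pi.sub_apply, Pi.smul_apply, Finset.sum_apply, smul_eq_mul,
      Finset.sum_sub_distrib, Finset.sum_const, Finset.card_univ, Fintype.card_fin,
      nsmul_eq_mul]
    field_simp
  simp only [coord, Finset.mul_sum (s := (Finset.univ : Finset (Fin n))), mul_pow]
  rw [Finset.sum_comm]
  calc ∑ i, ∑ I : Fin k → Fin n, (∏ t, x (I t)) * ((k : ℝ)⁻¹ ^ 2 * (∑ t, f i (I t)) ^ 2)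
      = ∑ i, (k : ℝ)⁻¹ * ∑ a, x a * f i a ^ 2 := by
        refine Finset.sum_congr rfl fun i _ => ?_
        simp only [mul_left_comm _ ((k : ℝ)⁻¹ ^ 2), ← Finset.mul_sum,
          sum_prod_weights_mul_sum_sq hx1 (mean i)]
        field_simp
    _ ≤ ∑ i, (k : ℝ)⁻¹ * x i := by
        gcongr with i
        exact var i
    _ = (k : ℝ)⁻¹ := by rw [← Finset.mul_sum, hx1, mul_one]

/-- sampling bound.  If `I_1, …, I_k` are i.i.d. indices drawn from the
distribution `x* ∈ Δⁿ` (the probability of a sample `I : Fin k → Fin n` being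
`∏ t, x* (I t)`) and `x'` is the empirical distribution `(1/k)·Σ_t e_{I_t}`, then the
probability that `‖x' − x*‖_p ≥ ε/(4λ)` is at most `8λ√p/(ε√k)`. -/
theorem sampled_strategy_far_probability_bound {n : ℕ}
    (xstar : Fin n → ℝ) (hxstar : xstar ∈ stdSimplex ℝ (Fin n))
    (p lam ε : ℝ) (hp : 2 ≤ p) (hlam : 0 < lam) (hε : 0 < ε)
    (k : ℕ) (hk : 0 < k) :
    ∑ I : Fin k → Fin n,
        (if ε / (4 * lam)
            ≤ lpNorm p ((k : ℝ)⁻¹ • ((∑ t, Pi.single (I t) 1 : Fin n → ℝ)) - xstar)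
          then ∏ t, xstar (I t) else 0)
      ≤ 8 * lam * Real.sqrt p / (ε * Real.sqrt k) := by
  have hw (I : Fin k → Fin n) : 0 ≤ ∏ t, xstar (I t) :=
    Finset.prod_nonneg fun t _ => hxstar.1 _
  have hk' : (0 : ℝ) < k := by exact_mod_cast hk
  set δ := ε / (4 * lam) with hδ
  have hδ0 : 0 < δ := by positivity
  set P := ∑ I : Fin k → Fin n,
    (if δ ≤ lpNorm p ((k : ℝ)⁻¹ • ((∑ t, Pi.single (I t) 1 : Fin n → ℝ)) - xstar)
      then ∏ t, xstar (I t) else 0) with hP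
  have hP1 : P ≤ 1 := by
    rw [← sum_prod_weights hxstar.2 k]
    refine Finset.sum_le_sum fun I _ => ?_
    split_ifs
    exacts [le_rfl, hw I]
  set a := (δ * Real.sqrt k)⁻¹ with ha
  have ha0 : 0 < a := by positivity
  have hPa : P ≤ a ^ 2 := by
    have chebyshev : P ≤ (δ ^ 2)⁻¹ * ∑ I : Fin k → Fin n, (∏ t, xstar (I t)) *
        ∑ i, ((k : ℝ)⁻¹ • ((∑ t, Pi.single (I t) 1 : Fin n → ℝ)) - xstar) i ^ 2 := by
      rw [Finset.mul_sum]
      refine Finset.sum_le_sum fun I _ => ?_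
      split_ifs with h
      · have hS := (Real.le_sqrt' hδ0).1 (h.trans (lpNorm_le_sqrt_sum_sq hp _))
        rw [le_inv_mul_iff₀ (by positivity), mul_comm]
        exact mul_le_mul_of_nonneg_left hS (hw I)
      · exact mul_nonneg (by positivity)
          (mul_nonneg (hw I) (Finset.sum_nonneg fun i _ => sq_nonneg _))
    calc P ≤ (δ ^ 2)⁻¹ * (k : ℝ)⁻¹ := chebyshev.trans
          (mul_le_mul_of_nonneg_left (sum_prod_weights_mul_sq_dist_le hxstar hk) (by positivity))
      _ = a ^ 2 := by rw [ha, inv_pow, mul_pow, Real.sq_sqrt hk'.le, mul_inv]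
  have hPa' : P ≤ a := by
    rcases le_total 1 a with h | h
    · exact hP1.trans h
    · nlinarith
  have hsp : 1 ≤ Real.sqrt p := Real.one_le_sqrt.2 (by linarith)
  calc P ≤ a := hPa'
    _ ≤ 2 * Real.sqrt p * a := by nlinarith
    _ = 8 * lam * Real.sqrt p / (ε * Real.sqrt k) := by
        rw [ha, hδ]
        field_simp
        norm_num
end

section
/- There is an absolute constant c > 0 with the following property. Let (R, C, f_r, f_c) be a two-player penalty game whose penalty functions f_r, f_c : Δⁿ → ℝ are λ-Lipschitz with respect to the L_p norm for some 2 ≤ p < ∞ and λ > 0, let (x*, y*) be an exact equilibrium of the game, let 0 < ε < 1, and let k be an integer with k ≥ c·(p·λ² + log(n+1))/ε². Then there exists a k-uniform strategy profile (x', y') ∈ Δⁿ × Δⁿ such that: (1) (x', y') is an ε-equilibrium of the game; (2) |T_r(x', y') − T_r(x*, y*)| ≤ ε/2; and (3) |T_c(x', y') − T_c(x*, y*)| ≤ ε/2. -/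
open Finset Matrix

/-- Row player's utility in a two-player penalty game: `xᵀRy − f_r(x)`. -/
noncomputable def Tr {n : ℕ} (R : Matrix (Fin n) (Fin n) ℝ) (fr : (Fin n → ℝ) → ℝ)
    (x y : Fin n → ℝ) : ℝ := x ⬝ᵥ R.mulVec y - fr x

/-- Column player's utility in a two-player penalty game: `xᵀCy − f_c(y)`. -/
noncomputable def Tc {n : ℕ} (C : Matrix (Fin n) (Fin n) ℝ) (fc : (Fin n → ℝ) → ℝ)
    (x y : Fin n → ℝ) : ℝ := x ⬝ᵥ C.mulVec y - fc y

/-- A strategy is `k`-uniform if it is a uniform average of `k` pure strategies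
(repetitions allowed). -/
def kUniform {n : ℕ} (k : ℕ) (x : Fin n → ℝ) : Prop :=
  ∃ v : Fin k → Fin n, x = (k : ℝ)⁻¹ • ((∑ t, Pi.single (v t) 1 : Fin n → ℝ))

/-- A weighted average bounded by `M` has a term bounded by `M`. -/
theorem exists_le_of_stdSimplex_sum_le {ι : Type*} [Fintype ι] {x : ι → ℝ}
    (hx : x ∈ stdSimplex ℝ ι) {g : ι → ℝ} {M : ℝ} (h : ∑ i, x i * g i ≤ M) :
    ∃ i, g i ≤ M := by
  by_contra! hg
  have hpos : ∃ i, 0 < x i := by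
    by_contra! h0
    have : ∑ i, x i ≤ 0 := Finset.sum_nonpos fun i _ => h0 i
    linarith [hx.2]
  obtain ⟨i₀, hi₀⟩ := hpos
  have : ∑ i, x i * M < ∑ i, x i * g i :=
    Finset.sum_lt_sum (fun i _ => mul_le_mul_of_nonneg_left (hg i).le (hx.1 i))
      ⟨i₀, Finset.mem_univ _, mul_lt_mul_of_pos_left (hg i₀) hi₀⟩
  rw [← Finset.sum_mul, hx.2, one_mul] at this
  linarith

/-- The average of `exp (s * z)` for a centred `z` with `|z| ≤ 1` and `0 ≤ s ≤ 1`. -/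
theorem stdSimplex_sum_exp_le {ι : Type*} [Fintype ι] {x : ι → ℝ}
    (hx : x ∈ stdSimplex ℝ ι) {z : ι → ℝ} (hz : ∀ i, |z i| ≤ 1) (hc : ∑ i, x i * z i = 0)
    {s : ℝ} (hs0 : 0 ≤ s) (hs1 : s ≤ 1) :
    ∑ i, x i * Real.exp (s * z i) ≤ Real.exp (s ^ 2) := by
  have hterm : ∀ i, Real.exp (s * z i) ≤ 1 + s * z i + s ^ 2 := by
    intro i
    have habs : |s * z i| ≤ 1 := by
      rw [abs_mul, abs_of_nonneg hs0]
      exact mul_le_one₀ hs1 (abs_nonneg _) (hz i)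
    have h1 := (abs_le.1 (Real.abs_exp_sub_one_sub_id_le habs)).2
    have h2 : z i ^ 2 ≤ 1 := (sq_le_one_iff_abs_le_one _).2 (hz i)
    nlinarith [mul_le_mul_of_nonneg_left h2 (sq_nonneg s)]
  calc ∑ i, x i * Real.exp (s * z i)
      ≤ ∑ i, x i * (1 + s * z i + s ^ 2) :=
        Finset.sum_le_sum fun i _ => mul_le_mul_of_nonneg_left (hterm i) (hx.1 i)
    _ = (∑ i, x i) * (1 + s ^ 2) + s * ∑ i, x i * z i := by
        rw [Finset.sum_mul, Finset.mul_sum, ← Finset.sum_add_distrib]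
        exact Finset.sum_congr rfl fun i _ => by ring
    _ = s ^ 2 + 1 := by rw [hx.2, hc]; ring
    _ ≤ Real.exp (s ^ 2) := Real.add_one_le_exp _

/-- Moving by `e_i - x`, with `i` drawn from `x`, increases the expected squared Euclidean norm by
at most one. -/
theorem stdSimplex_sum_sq_step_le {ι : Type*} [Fintype ι] [DecidableEq ι] {x : ι → ℝ}
    (hx : x ∈ stdSimplex ℝ ι) (u : ι → ℝ) :
    ∑ i, x i * ∑ l, ((Pi.single i 1 : ι → ℝ) l - x l + u l) ^ 2 ≤ ∑ l, u l ^ 2 + 1 := by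
  have hl : ∀ l, ∑ i, x i * ((Pi.single i 1 : ι → ℝ) l - x l + u l) ^ 2
      = u l ^ 2 + x l - x l ^ 2 := by
    intro l
    have h1 : ∀ i, x i * ((Pi.single i 1 : ι → ℝ) l - x l + u l) ^ 2
        = x i * (u l - x l) ^ 2
          + (if l = i then x i * (1 + 2 * (u l - x l)) else 0) := by
      intro i
      rw [Pi.single_apply]
      split_ifs <;> ring
    rw [Finset.sum_congr rfl fun i _ => h1 i, Finset.sum_add_distrib, ← Finset.sum_mul, hx.2,
      Finset.sum_ite_eq]
    simp only [Finset.mem_univ, if_true]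
    ring
  simp only [Finset.mul_sum]
  rw [Finset.sum_comm, Finset.sum_congr rfl fun l _ => hl l, ← hx.2, ← Finset.sum_add_distrib]
  exact Finset.sum_le_sum fun l _ => by nlinarith [sq_nonneg (x l)]

/-- Greedy sampling: a sequence of pure strategies keeping a combined potential below its initial
value. -/
theorem exists_potential_le {ι J : Type*} [Fintype ι] [DecidableEq ι] [Fintype J] {x : ι → ℝ}
    (hx : x ∈ stdSimplex ℝ ι) {b : J → ι → ℝ} (hb : ∀ j i, |b j i| ≤ 1)
    (hc : ∀ j, ∑ i, x i * b j i = 0) {s A : ℝ} (hs0 : 0 ≤ s) (hs1 : s ≤ 1) (hA : 0 ≤ A) (m : ℕ) :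
    ∃ v : Fin m → ι,
      A * (∑ l, (∑ t, ((Pi.single (v t) 1 : ι → ℝ) l - x l)) ^ 2 - m)
        + Real.exp (-(m * s ^ 2)) * ∑ j, Real.exp (s * ∑ t, b j (v t)) ≤ Fintype.card J := by
  induction m with
  | zero => exact ⟨Fin.elim0, by simp⟩
  | succ m ih =>
    obtain ⟨v, hv⟩ := ih
    set u : ι → ℝ := fun l => ∑ t, ((Pi.single (v t) 1 : ι → ℝ) l - x l)
    set B : J → ℝ := fun j => ∑ t, b j (v t)
    obtain ⟨i, hi⟩ : ∃ i, A * (∑ l, ((Pi.single i 1 : ι → ℝ) l - x l + u l) ^ 2 - (m + 1))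
        + Real.exp (-((m + 1) * s ^ 2)) * ∑ j, Real.exp (s * (b j i + B j))
        ≤ Fintype.card J := by
      refine exists_le_of_stdSimplex_sum_le hx (le_trans ?_ hv)
      have hsq := stdSimplex_sum_sq_step_le hx u
      have hexp : ∑ i, x i * ∑ j, Real.exp (s * (b j i + B j))
          ≤ Real.exp (s ^ 2) * ∑ j, Real.exp (s * B j) := by
        simp only [Finset.mul_sum]
        rw [Finset.sum_comm]
        refine Finset.sum_le_sum fun j _ => ?_
        have h1 := mul_le_mul_of_nonneg_right
          (stdSimplex_sum_exp_le hx (hb j) (hc j) hs0 hs1) (Real.exp_pos (s * B j)).le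
        refine le_trans (le_of_eq ?_) h1
        rw [Finset.sum_mul]
        exact Finset.sum_congr rfl fun i _ => by rw [mul_add, Real.exp_add]; ring
      have hsplit : Real.exp (-((m + 1) * s ^ 2)) * Real.exp (s ^ 2)
          = Real.exp (-(m * s ^ 2)) := by
        rw [← Real.exp_add]; congr 1; ring
      have e : ∑ i, x i * (A * (∑ l, ((Pi.single i 1 : ι → ℝ) l - x l + u l) ^ 2 - (m + 1))
            + Real.exp (-((m + 1) * s ^ 2)) * ∑ j, Real.exp (s * (b j i + B j)))
          = A * (∑ i, x i * ∑ l, ((Pi.single i 1 : ι → ℝ) l - x l + u l) ^ 2)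
            - A * (m + 1) * ∑ i, x i
            + Real.exp (-((m + 1) * s ^ 2))
              * ∑ i, x i * ∑ j, Real.exp (s * (b j i + B j)) := by
        rw [Finset.mul_sum Finset.univ _ A, Finset.mul_sum Finset.univ _ (A * (m + 1)),
          Finset.mul_sum Finset.univ _ (Real.exp _), ← Finset.sum_sub_distrib,
          ← Finset.sum_add_distrib]
        exact Finset.sum_congr rfl fun i _ => by ring
      rw [e, hx.2]
      have h1 := mul_le_mul_of_nonneg_left hsq hA
      have h2 := mul_le_mul_of_nonneg_left hexp (Real.exp_pos (-((m + 1) * s ^ 2))).le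
      rw [← mul_assoc, hsplit] at h2
      linarith
    refine ⟨Fin.cons i v, ?_⟩
    simp only [Fin.sum_univ_succ, Fin.cons_zero, Fin.cons_succ]
    push_cast
    exact hi

/-- For `p ≥ 2` the `L_p` norm is at most the Euclidean norm. -/
theorem lpNorm_le_of_sum_sq_le {n : ℕ} {p D : ℝ} (hp : 2 ≤ p) (hD : 0 < D) {u : Fin n → ℝ}
    (hu : ∑ i, u i ^ 2 ≤ D ^ 2) : lpNorm p u ≤ D := by
  have hterm : ∀ i, |u i| ^ p ≤ D ^ (p - 2) * u i ^ 2 := by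
    intro i
    have hi : |u i| ≤ D := by
      refine abs_le_of_sq_le_sq (le_trans ?_ hu) hD.le
      exact Finset.single_le_sum (f := fun i => u i ^ 2) (fun i _ => sq_nonneg _)
        (Finset.mem_univ i)
    have h1 : |u i| ^ p = |u i| ^ (p - 2) * u i ^ 2 := by
      rw [← sq_abs, ← Real.rpow_natCast, ← Real.rpow_add_of_nonneg (abs_nonneg _) (by linarith)
        (by norm_num)]
      norm_num
    rw [h1]
    exact mul_le_mul_of_nonneg_right
      (Real.rpow_le_rpow (abs_nonneg _) hi (by linarith)) (sq_nonneg _)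
  have hsum : ∑ i, |u i| ^ p ≤ D ^ p := by
    calc ∑ i, |u i| ^ p ≤ ∑ i, D ^ (p - 2) * u i ^ 2 := Finset.sum_le_sum fun i _ => hterm i
      _ = D ^ (p - 2) * ∑ i, u i ^ 2 := by rw [Finset.mul_sum]
      _ ≤ D ^ (p - 2) * D ^ 2 :=
        mul_le_mul_of_nonneg_left hu (Real.rpow_nonneg hD.le _)
      _ = D ^ p := by
        rw [← Real.rpow_natCast D 2, ← Real.rpow_add hD]; norm_num
  have h0 : 0 ≤ ∑ i, |u i| ^ p := Finset.sum_nonneg fun i _ => Real.rpow_nonneg (abs_nonneg _) _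
  calc lpNorm p u ≤ (D ^ p) ^ (1 / p) := Real.rpow_le_rpow h0 hsum (by positivity)
    _ = D := by
      rw [← Real.rpow_mul hD.le, mul_one_div_cancel (by linarith), Real.rpow_one]

theorem kUniform.mem_stdSimplex {n k : ℕ} (hk : k ≠ 0) {x : Fin n → ℝ} (h : kUniform k x) :
    x ∈ stdSimplex ℝ (Fin n) := by
  obtain ⟨v, rfl⟩ := h
  refine ⟨fun i => ?_, ?_⟩
  · simp only [Pi.smul_apply, Finset.sum_apply, smul_eq_mul]
    refine mul_nonneg (by positivity) (Finset.sum_nonneg fun t _ => ?_)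
    rw [Pi.single_apply]
    split_ifs <;> norm_num
  · simp only [Pi.smul_apply, Finset.sum_apply, smul_eq_mul]
    rw [← Finset.mul_sum, Finset.sum_comm]
    simp [Finset.sum_pi_single', hk]

/-- A mixed strategy `x` is approximated by a `k`-uniform one, simultaneously against finitely many
`[0,1]`-valued test vectors and in Euclidean norm. -/
theorem exists_kUniform_approx {n k : ℕ} {K : Type*} [Fintype K] [Nonempty K] (hk : k ≠ 0)
    {x : Fin n → ℝ} (hx : x ∈ stdSimplex ℝ (Fin n)) {a : K → Fin n → ℝ}
    (ha : ∀ j i, a j i ∈ Set.Icc (0 : ℝ) 1) {δ : ℝ} (hδ0 : 0 < δ) (hδ1 : δ ≤ 1)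
    (hlog : 4 * Real.log (4 * Fintype.card K) ≤ δ ^ 2 * k) :
    ∃ x' : Fin n → ℝ, kUniform k x' ∧ ∑ l, (x' l - x l) ^ 2 ≤ 2 / k ∧
      ∀ j, |x' ⬝ᵥ a j - x ⬝ᵥ a j| ≤ δ := by
  have hkpos : (0 : ℝ) < k := by exact_mod_cast Nat.pos_of_ne_zero hk
  have hKpos : (0 : ℝ) < Fintype.card K := by exact_mod_cast Fintype.card_pos
  have hmean : ∀ j, x ⬝ᵥ a j ∈ Set.Icc (0 : ℝ) 1 := by
    intro j
    refine ⟨Finset.sum_nonneg fun i _ => mul_nonneg (hx.1 i) (ha j i).1, ?_⟩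
    rw [← hx.2]
    exact Finset.sum_le_sum fun i _ => mul_le_of_le_one_right (hx.1 i) (ha j i).2
  set b₀ : K → Fin n → ℝ := fun j i => a j i - x ⬝ᵥ a j with hb₀
  have hb₀1 : ∀ j i, |b₀ j i| ≤ 1 := fun j i => abs_le.2
    ⟨by simp only [hb₀]; linarith [(ha j i).1, (hmean j).2],
      by simp only [hb₀]; linarith [(ha j i).2, (hmean j).1]⟩
  have hb₀c : ∀ j, ∑ i, x i * b₀ j i = 0 := by
    intro j
    simp only [hb₀, mul_sub, Finset.sum_sub_distrib, ← Finset.sum_mul, hx.2, one_mul]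
    exact sub_self _
  set N : ℝ := (Fintype.card (K ⊕ K) : ℝ) with hN
  have hN2 : N = 2 * Fintype.card K := by rw [hN, Fintype.card_sum]; push_cast; ring
  have hNpos : 0 < N := by rw [hN2]; positivity
  obtain ⟨v, hv⟩ := exists_potential_le (J := K ⊕ K) hx
    (b := Sum.elim b₀ fun j i => -b₀ j i) (s := δ / 2) (A := N / k)
    (by rintro (j | j) i <;> simp [hb₀1])
    (by rintro (j | j) <;> simp [hb₀c]) (by linarith) (by linarith) (by positivity) k
  set S : ℝ := ∑ l, (∑ t, ((Pi.single (v t) 1 : Fin n → ℝ) l - x l)) ^ 2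
  set E : ℝ := ∑ j, Real.exp (δ / 2 * ∑ t, (Sum.elim b₀ fun j i => -b₀ j i) j (v t))
  have hS0 : 0 ≤ S := Finset.sum_nonneg fun l _ => sq_nonneg _
  have hE0 : 0 ≤ E := Finset.sum_nonneg fun l _ => (Real.exp_pos _).le
  have hexpand : N / k * (S - k) = N / k * S - N := by field_simp
  rw [hexpand] at hv
  have hSle : S ≤ 2 * k := by
    have h1 : 0 ≤ Real.exp (-(k * (δ / 2) ^ 2)) * E := by positivity
    have h2 : N / k * S ≤ 2 * N := by linarith
    rw [div_mul_eq_mul_div, div_le_iff₀ hkpos] at h2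
    nlinarith
  have hEle : E ≤ 2 * N * Real.exp (k * (δ / 2) ^ 2) := by
    have h1 : 0 ≤ N / k * S := by positivity
    have h2 : Real.exp (-(k * (δ / 2) ^ 2)) * E ≤ 2 * N := by linarith
    rw [Real.exp_neg, inv_mul_le_iff₀ (Real.exp_pos _)] at h2
    linarith
  have hlin : ∀ j : K ⊕ K, ∑ t, (Sum.elim b₀ fun j i => -b₀ j i) j (v t) ≤ δ * k := by
    intro j
    have h1 : Real.exp (δ / 2 * ∑ t, (Sum.elim b₀ fun j i => -b₀ j i) j (v t)) ≤ E :=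
      Finset.single_le_sum
        (f := fun j => Real.exp (δ / 2 * ∑ t, (Sum.elim b₀ fun j i => -b₀ j i) j (v t)))
        (fun j _ => (Real.exp_pos _).le) (Finset.mem_univ j)
    have h2 := h1.trans hEle
    have h3 : 2 * N = Real.exp (Real.log (4 * Fintype.card K)) := by
      rw [Real.exp_log (by positivity), hN2]; ring
    rw [h3, ← Real.exp_add, Real.exp_le_exp] at h2
    by_contra! hlt
    nlinarith
  refine ⟨_, ⟨v, rfl⟩, ?_, fun j => ?_⟩
  · have h1 : ∀ l, (((k : ℝ)⁻¹ • (∑ t, Pi.single (v t) 1 : Fin n → ℝ)) l - x l) ^ 2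
        = ((k : ℝ) ^ 2)⁻¹ * (∑ t, ((Pi.single (v t) 1 : Fin n → ℝ) l - x l)) ^ 2 := by
      intro l
      simp only [Pi.smul_apply, Finset.sum_apply, smul_eq_mul, Finset.sum_sub_distrib,
        Finset.sum_const, Finset.card_univ, Fintype.card_fin, nsmul_eq_mul]
      field_simp
    rw [Finset.sum_congr rfl fun l _ => h1 l, ← Finset.mul_sum, inv_mul_le_iff₀ (by positivity)]
    calc S ≤ 2 * k := hSle
      _ = (k : ℝ) ^ 2 * (2 / k) := by field_simp
  · have h1 : ((k : ℝ)⁻¹ • (∑ t, Pi.single (v t) 1 : Fin n → ℝ)) ⬝ᵥ a j - x ⬝ᵥ a j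
        = (k : ℝ)⁻¹ * ∑ t, b₀ j (v t) := by
      rw [smul_dotProduct, sum_dotProduct]
      simp only [single_dotProduct, hb₀, Finset.sum_sub_distrib, Finset.sum_const,
        Finset.card_univ, Fintype.card_fin, nsmul_eq_mul, smul_eq_mul, one_mul]
      field_simp
    have hp := hlin (Sum.inl j)
    have hm := hlin (Sum.inr j)
    simp only [Sum.elim_inl, Sum.elim_inr, Finset.sum_neg_distrib] at hp hm
    rw [h1, abs_mul, abs_of_pos (inv_pos.2 hkpos), inv_mul_le_iff₀ hkpos, mul_comm]
    exact abs_le.2 ⟨by linarith, hp⟩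

/-- Averaging a uniform bound over a mixed strategy. -/
theorem abs_dotProduct_sub_le {n : ℕ} {x : Fin n → ℝ} (hx : x ∈ stdSimplex ℝ (Fin n))
    {u w : Fin n → ℝ} {δ : ℝ} (h : ∀ i, |u i - w i| ≤ δ) : |x ⬝ᵥ u - x ⬝ᵥ w| ≤ δ := by
  rw [← dotProduct_sub]
  calc |∑ i, x i * (u i - w i)| ≤ ∑ i, |x i * (u i - w i)| := Finset.abs_sum_le_sum_abs _ _
    _ ≤ ∑ i, x i * δ := Finset.sum_le_sum fun i _ => by
        rw [abs_mul, abs_of_nonneg (hx.1 i)]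
        exact mul_le_mul_of_nonneg_left (h i) (hx.1 i)
    _ = δ := by rw [← Finset.sum_mul, hx.2, one_mul]

/-- A mixed strategy is approximated by a `k`-uniform one against the rows of two matrices and in
the value of a Lipschitz penalty. -/
theorem exists_kUniform_approx_penalty {n k : ℕ} {f : (Fin n → ℝ) → ℝ} {p lam ε : ℝ}
    (hp : 2 ≤ p) (hlam : 0 < lam)
    (hf : ∀ x ∈ stdSimplex ℝ (Fin n), ∀ y ∈ stdSimplex ℝ (Fin n),
      |f x - f y| ≤ lam * lpNorm p (x - y))
    {x : Fin n → ℝ} (hx : x ∈ stdSimplex ℝ (Fin n)) {M₁ M₂ : Matrix (Fin n) (Fin n) ℝ}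
    (hM₁ : ∀ i j, M₁ i j ∈ Set.Icc (0 : ℝ) 1) (hM₂ : ∀ i j, M₂ i j ∈ Set.Icc (0 : ℝ) 1)
    (hε0 : 0 < ε) (hε1 : ε < 1)
    (hk : 576 * (p * lam ^ 2 + Real.log ((n : ℝ) + 1)) / ε ^ 2 ≤ k) :
    ∃ x' ∈ stdSimplex ℝ (Fin n), kUniform k x' ∧ |f x' - f x| ≤ ε / 6 ∧
      (∀ j, |M₁.mulVec x' j - M₁.mulVec x j| ≤ ε / 6) ∧
      (∀ j, |M₂.mulVec x' j - M₂.mulVec x j| ≤ ε / 6) := by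
  have hn : 0 < n := by
    rcases Nat.eq_zero_or_pos n with rfl | h
    · simpa using hx.2
    · exact h
  have hn1 : (1 : ℝ) ≤ n := by exact_mod_cast hn
  have : Nonempty (Fin n) := ⟨⟨0, hn⟩⟩
  rw [div_le_iff₀ (by positivity)] at hk
  have hlog0 : 0 < Real.log ((n : ℝ) + 1) := Real.log_pos (by linarith)
  have hpl : 2 * lam ^ 2 ≤ p * lam ^ 2 := mul_le_mul_of_nonneg_right hp (sq_nonneg _)
  have hl2 : 0 < lam ^ 2 := by positivity
  have hk0 : k ≠ 0 := by
    rintro rfl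
    simp only [Nat.cast_zero, zero_mul] at hk
    linarith
  have hkpos : (0 : ℝ) < k := by exact_mod_cast Nat.pos_of_ne_zero hk0
  have hlog : Real.log (8 * n) ≤ 4 * Real.log ((n : ℝ) + 1) := by
    have h4 : 4 * Real.log ((n : ℝ) + 1) = Real.log (((n : ℝ) + 1) ^ 4) := by
      rw [Real.log_pow]; norm_num
    rw [h4]
    refine Real.log_le_log (by positivity) ?_
    have h2 : (4 : ℝ) * n ≤ (n + 1) ^ 2 := by nlinarith [sq_nonneg ((n : ℝ) - 1)]
    nlinarith
  obtain ⟨x', hx', hsq, hlin⟩ := exists_kUniform_approx (K := Fin n ⊕ Fin n) hk0 hx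
    (a := Sum.elim (fun i j => M₁ i j) fun i j => M₂ i j)
    (by rintro (j | j) i; exacts [hM₁ j i, hM₂ j i])
    (δ := ε / 6) (by linarith) (by linarith) (by
      have : (4 : ℝ) * Fintype.card (Fin n ⊕ Fin n) = 8 * n := by
        rw [Fintype.card_sum, Fintype.card_fin]; push_cast; ring
      rw [this]
      linarith)
  have hx's := hx'.mem_stdSimplex hk0
  refine ⟨x', hx's, hx', ?_, fun j => ?_, fun j => ?_⟩
  · have hD : lpNorm p (x' - x) ≤ ε / 6 / lam := by
      refine lpNorm_le_of_sum_sq_le hp (by positivity) (le_trans hsq ?_)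
      rw [div_pow, div_le_div_iff₀ hkpos hl2]
      linarith
    calc |f x' - f x| ≤ lam * lpNorm p (x' - x) := hf _ hx's _ hx
      _ ≤ lam * (ε / 6 / lam) := mul_le_mul_of_nonneg_left hD hlam.le
      _ = ε / 6 := by field_simp
  · have := hlin (Sum.inl j)
    rw [dotProduct_comm, dotProduct_comm x] at this
    exact this
  · have := hlin (Sum.inr j)
    rw [dotProduct_comm, dotProduct_comm x] at this
    exact this

/-- there is an absolute constant `c > 0` such that every penalty game with
`λ_p`-Lipschitz penalty functions that has an exact equilibrium `(x*, y*)` also has, for every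
`0 < ε < 1` and every `k ≥ c·(pλ² + log(n+1))/ε²`, a `k`-uniform `ε`-equilibrium `(x', y')`
whose utilities are `ε/2`-close to those at `(x*, y*)`. -/
theorem penalty_game_kUniform_approx_equilibrium :
    ∃ c : ℝ, 0 < c ∧
      ∀ (n : ℕ) (R C : Matrix (Fin n) (Fin n) ℝ),
        (∀ i j, R i j ∈ Set.Icc (0 : ℝ) 1) → (∀ i j, C i j ∈ Set.Icc (0 : ℝ) 1) →
        ∀ (fr fc : (Fin n → ℝ) → ℝ) (p lam : ℝ), 2 ≤ p → 0 < lam →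
        (∀ x ∈ stdSimplex ℝ (Fin n), ∀ y ∈ stdSimplex ℝ (Fin n),
          |fr x - fr y| ≤ lam * lpNorm p (x - y)) →
        (∀ x ∈ stdSimplex ℝ (Fin n), ∀ y ∈ stdSimplex ℝ (Fin n),
          |fc x - fc y| ≤ lam * lpNorm p (x - y)) →
        ∀ xstar ∈ stdSimplex ℝ (Fin n), ∀ ystar ∈ stdSimplex ℝ (Fin n),
        (∀ x ∈ stdSimplex ℝ (Fin n), Tr R fr x ystar ≤ Tr R fr xstar ystar) →
        (∀ y ∈ stdSimplex ℝ (Fin n), Tc C fc xstar y ≤ Tc C fc xstar ystar) →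
        ∀ ε : ℝ, 0 < ε → ε < 1 →
        ∀ k : ℕ, c * (p * lam ^ 2 + Real.log ((n : ℝ) + 1)) / ε ^ 2 ≤ k →
        ∃ x' ∈ stdSimplex ℝ (Fin n), ∃ y' ∈ stdSimplex ℝ (Fin n),
          kUniform k x' ∧ kUniform k y' ∧
          (∀ x ∈ stdSimplex ℝ (Fin n), Tr R fr x y' ≤ Tr R fr x' y' + ε) ∧
          (∀ y ∈ stdSimplex ℝ (Fin n), Tc C fc x' y ≤ Tc C fc x' y' + ε) ∧
          |Tr R fr x' y' - Tr R fr xstar ystar| ≤ ε / 2 ∧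
          |Tc C fc x' y' - Tc C fc xstar ystar| ≤ ε / 2 := by
  refine ⟨576, by norm_num, ?_⟩
  intro n R C hR hC fr fc p lam hp hlam hfr hfc xs hxs ys hys hex hey ε hε0 hε1 k hk
  obtain ⟨x', hx', hux, hfx, hRx, hCx⟩ := exists_kUniform_approx_penalty hp hlam hfr hxs
    (M₁ := Rᵀ) (M₂ := Cᵀ) (fun i j => hR j i) (fun i j => hC j i) hε0 hε1 hk
  obtain ⟨y', hy', huy, hfy, hRy, hCy⟩ := exists_kUniform_approx_penalty hp hlam hfc hys
    hR hC hε0 hε1 hk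
  have hflip : ∀ (M : Matrix (Fin n) (Fin n) ℝ) (x y : Fin n → ℝ),
      x ⬝ᵥ M.mulVec y = y ⬝ᵥ Mᵀ.mulVec x := fun M x y => by
    rw [dotProduct_mulVec, mulVec_transpose, dotProduct_comm]
  have hRr := fun x (hx : x ∈ stdSimplex ℝ (Fin n)) => abs_le.1 (abs_dotProduct_sub_le hx hRy)
  have hCr := fun x (hx : x ∈ stdSimplex ℝ (Fin n)) => abs_le.1 (abs_dotProduct_sub_le hx hCy)
  have hRc := fun y (hy : y ∈ stdSimplex ℝ (Fin n)) => abs_le.1 (abs_dotProduct_sub_le hy hRx)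
  have hCc := fun y (hy : y ∈ stdSimplex ℝ (Fin n)) => abs_le.1 (abs_dotProduct_sub_le hy hCx)
  simp only [← hflip] at hRc hCc
  rw [abs_le] at hfx hfy
  unfold Tr Tc at *
  have r₁ := hRr x' hx'
  have r₂ := hRc ys hys
  have c₁ := hCc y' hy'
  have c₂ := hCr xs hxs
  refine ⟨x', hx', y', hy', hux, huy, fun x hx => ?_, fun y hy => ?_, ?_, ?_⟩
  · have := hRr x hx
    have := hex x hx
    linarith
  · have := hCc y hy
    have := hey y hy
    linarith
  · exact abs_le.2 ⟨by linarith, by linarith⟩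
  · exact abs_le.2 ⟨by linarith, by linarith⟩
end
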